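/- Let ρ be a density matrix on ℂ^{dA} ⊗ ℂ^{dB} with support projection Π_ρ. Then inf{ ‖Y^{T_B}‖_∞ : Y Hermitian, −Y ≤ Π_ρ^{T_B} ≤ Y } = sup{ tr[Π_ρ σ] : σ ∈ WD(A:B) }. Equivalently, E_WD,2(ρ) = D_min(ρ‖WD(A:B)). -/

import Mathlib

open scoped Kronecker ComplexOrder Matrix

attribute [local instance] Classical.propDecidable

noncomputable section

namespace QIT

variable {n : Type*} [Fintype n] [DecidableEq n]

/-- Base-2 matrix logarithm taken on the support (junk value `0` for non-Hermitian input). -/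
def matLog (A : Matrix n n ℂ) : Matrix n n ℂ :=
  if hA : A.IsHermitian then
    (hA.eigenvectorUnitary : Matrix n n ℂ) *
      Matrix.diagonal (fun i => if hA.eigenvalues i = 0 then (0 : ℂ)
        else (Real.logb 2 (hA.eigenvalues i) : ℂ)) *
      (hA.eigenvectorUnitary : Matrix n n ℂ)ᴴ
  else 0

/-- Orthogonal projection onto the support of a Hermitian matrix. -/
def suppProj (A : Matrix n n ℂ) : Matrix n n ℂ :=
  if hA : A.IsHermitian then
    (hA.eigenvectorUnitary : Matrix n n ℂ) *
      Matrix.diagonal (fun i => if hA.eigenvalues i = 0 then (0 : ℂ) else 1) *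
      (hA.eigenvectorUnitary : Matrix n n ℂ)ᴴ
  else 0

/-- Support inclusion `supp ρ ⊆ supp σ`, phrased via kernels. -/
def suppLE (ρ σ : Matrix n n ℂ) : Prop :=
  ∀ x : n → ℂ, σ.mulVec x = 0 → ρ.mulVec x = 0

/-- Umegaki relative entropy (base 2), `+∞` when supports are not included. -/
def relEnt (ρ σ : Matrix n n ℂ) : EReal :=
  if suppLE ρ σ then (((ρ * (matLog ρ - matLog σ)).trace).re : EReal) else ⊤

/-- Classical relative-entropy summand `p log₂(p/q)` with conventions
`0 · log(0/q) = 0` and `p · log(p/0) = +∞` for `p ≠ 0`. -/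
def klTerm (p q : ℝ) : EReal :=
  if p = 0 then 0 else if q = 0 then ⊤ else ((p * Real.logb 2 (p / q) : ℝ) : EReal)

/-- A finite POVM. -/
def IsPOVM {m : ℕ} (M : Fin m → Matrix n n ℂ) : Prop :=
  (∀ x, (M x).PosSemidef) ∧ ∑ x, M x = 1

/-- Measured relative entropy (base 2). -/
def measRelEnt (ρ σ : Matrix n n ℂ) : EReal :=
  ⨆ (m : ℕ) (M : Fin m → Matrix n n ℂ) (_ : IsPOVM M),
    ∑ x, klTerm ((M x * ρ).trace).re ((M x * σ).trace).re

/-- Trace norm: sum of singular values. -/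
def traceNorm (A : Matrix n n ℂ) : ℝ :=
  ∑ i, Real.sqrt ((Matrix.posSemidef_conjTranspose_mul_self A).1.eigenvalues i)

/-- Operator (spectral) norm: largest singular value. -/
def opNorm (A : Matrix n n ℂ) : ℝ :=
  ⨆ i, Real.sqrt ((Matrix.posSemidef_conjTranspose_mul_self A).1.eigenvalues i)

/-- Partial transpose on the second tensor factor. -/
def ptB {α β : Type*} (X : Matrix (α × β) (α × β) ℂ) : Matrix (α × β) (α × β) ℂ :=
  Matrix.of fun p q => X (p.1, q.2) (q.1, p.2)

/-- Kronecker product of two bipartite matrices, reindexed to the bipartition (A×A') : (B×B'). -/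
def kron2 {α β γ δ : Type*} (X : Matrix (α × β) (α × β) ℂ) (Y : Matrix (γ × δ) (γ × δ) ℂ) :
    Matrix ((α × γ) × β × δ) ((α × γ) × β × δ) ℂ :=
  Matrix.reindex (Equiv.prodProdProdComm α β γ δ) (Equiv.prodProdProdComm α β γ δ) (X ⊗ₖ Y)

/-- The permutation unitary on `(ℂ^d)^{⊗ m}`. -/
def permMat (d m : ℕ) (π : Equiv.Perm (Fin m)) :
    Matrix (Fin m → Fin d) (Fin m → Fin d) ℂ :=
  Matrix.of fun f g => if f ∘ π = g then 1 else 0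

/-- Membership in the `PPT_k` set. -/
def memPPTk {α β : Type*} [Fintype α] [Fintype β] [DecidableEq α] [DecidableEq β]
    (k : ℕ) (X : Matrix (α × β) (α × β) ℂ) : Prop :=
  X.PosSemidef ∧ ∃ ω : ℕ → Matrix (α × β) (α × β) ℂ,
    ω 1 = X ∧ (∀ i ∈ Finset.Icc 1 k, (ω i).IsHermitian) ∧
    (∀ i ∈ Finset.Icc 1 (k - 1),
      ((ω (i + 1)) - ptB (ω i)).PosSemidef ∧ ((ω (i + 1)) + ptB (ω i)).PosSemidef) ∧
    traceNorm (ptB (ω k)) ≤ 1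

/-- Membership in the Rains set. -/
def memRains {α β : Type*} [Fintype α] [Fintype β] [DecidableEq α] [DecidableEq β]
    (σ : Matrix (α × β) (α × β) ℂ) : Prop :=
  σ.PosSemidef ∧ traceNorm (ptB σ) ≤ 1


/-- The Wang–Duan set `WD(A:B)`. -/
def memWD {dA dB : ℕ} (σ : Matrix (Fin dA × Fin dB) (Fin dA × Fin dB) ℂ) : Prop :=
  σ.IsHermitian ∧ ∃ Y : Matrix (Fin dA × Fin dB) (Fin dA × Fin dB) ℂ,
    Y.IsHermitian ∧ (ptB σ + Y).PosSemidef ∧ (Y - ptB σ).PosSemidef ∧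
    traceNorm (ptB Y) ≤ 1

section Duality

open scoped Matrix.Norms.L2Operator MatrixOrder

section Norms

/-- The singular values of a Hermitian matrix are the absolute values of its eigenvalues. -/
lemma traceNorm_eq_sum_abs_eigenvalues {Y : Matrix n n ℂ} (hY : Y.IsHermitian) :
    traceNorm Y = ∑ i, |hY.eigenvalues i| := by
  have hcfc : Yᴴ * Y = cfc (fun x : ℝ => x ^ 2) Y := by
    rw [cfc_pow_id (R := ℝ) Y 2 hY.isSelfAdjoint, hY.eq, sq]
  have h1 := (Matrix.posSemidef_conjTranspose_mul_self Y).1.roots_charpoly_eq_eigenvalues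
  have h2 : (Yᴴ * Y).charpoly.roots =
      Multiset.map (fun i => (((hY.eigenvalues i) ^ 2 : ℝ) : ℂ)) Finset.univ.val := by
    rw [hcfc, hY.charpoly_cfc_eq, Polynomial.roots_prod]
    · simp only [Polynomial.roots_X_sub_C, Multiset.bind_singleton]
      rfl
    · exact Finset.prod_ne_zero_iff.2 fun i _ => Polynomial.X_sub_C_ne_zero _
  have h3 := congrArg (fun s => (Multiset.map (fun z : ℂ => Real.sqrt z.re) s).sum)
    (h1.symm.trans h2)
  simp only [Multiset.map_map, Function.comp_def, Complex.coe_algebraMap,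
    Complex.ofReal_re, Real.sqrt_sq_eq_abs] at h3
  exact h3

lemma traceNorm_nonneg (Y : Matrix n n ℂ) : 0 ≤ traceNorm Y :=
  Finset.sum_nonneg fun _ _ => Real.sqrt_nonneg _

lemma norm_apply_le (X : Matrix n n ℂ) (i j : n) : ‖X i j‖ ≤ ‖X‖ := by
  have h := Matrix.l2_opNorm_mulVec X (EuclideanSpace.single j 1)
  have h2 := (PiLp.norm_apply_le (WithLp.toLp 2 (X *ᵥ (EuclideanSpace.single j (1 : ℂ)))) i).trans h
  simpa using h2

lemma norm_star_unitary_mul_mul (U : Matrix.unitaryGroup n ℂ) (X : Matrix n n ℂ) :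
    ‖star (U : Matrix n n ℂ) * X * (U : Matrix n n ℂ)‖ = ‖X‖ := by
  rw [CStarRing.norm_mul_coe_unitary, ← Unitary.coe_star, CStarRing.norm_coe_unitary_mul]

lemma trace_mul_eq_sum_eigenvalues {Y : Matrix n n ℂ} (hY : Y.IsHermitian) (X : Matrix n n ℂ) :
    (X * Y).trace = ∑ i, (star (hY.eigenvectorUnitary : Matrix n n ℂ) * X *
      (hY.eigenvectorUnitary : Matrix n n ℂ)) i i * (hY.eigenvalues i : ℂ) := by
  conv_lhs => rw [hY.spectral_theorem, Unitary.conjStarAlgAut_apply, ← mul_assoc,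
    Matrix.trace_mul_comm, ← mul_assoc, ← mul_assoc]
  simp [Matrix.trace, Matrix.mul_diagonal]

/-- Hölder's inequality between the spectral norm and the trace norm. -/
lemma re_trace_mul_le {Y : Matrix n n ℂ} (hY : Y.IsHermitian) (X : Matrix n n ℂ) :
    ((X * Y).trace).re ≤ ‖X‖ * traceNorm Y := by
  rw [trace_mul_eq_sum_eigenvalues hY, traceNorm_eq_sum_abs_eigenvalues hY, Finset.mul_sum]
  refine (Complex.re_le_norm _).trans ((norm_sum_le _ _).trans (Finset.sum_le_sum fun i _ => ?_))
  rw [norm_mul, Complex.norm_real, Real.norm_eq_abs]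
  gcongr
  rw [← norm_star_unitary_mul_mul hY.eigenvectorUnitary X]
  exact norm_apply_le _ _ _

/-- The trace norm is attained on a Hermitian contraction. -/
lemma exists_re_trace_mul_eq_traceNorm {Y : Matrix n n ℂ} (hY : Y.IsHermitian) :
    ∃ X : Matrix n n ℂ, X.IsHermitian ∧ ‖X‖ ≤ 1 ∧ ((X * Y).trace).re = traceNorm Y := by
  set U := hY.eigenvectorUnitary
  let D : Matrix n n ℂ := Matrix.diagonal fun i => ((SignType.sign (hY.eigenvalues i) : ℝ) : ℂ)
  have hD : Dᴴ = D := by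
    rw [Matrix.diagonal_conjTranspose]
    congr 1
    ext i
    simp
  refine ⟨U * D * star (U : Matrix n n ℂ), ?_, ?_, ?_⟩
  · simp only [Matrix.IsHermitian, Matrix.star_eq_conjTranspose, Matrix.conjTranspose_mul,
      Matrix.conjTranspose_conjTranspose, hD, mul_assoc]
  · rw [← Unitary.coe_star, CStarRing.norm_mul_coe_unitary, CStarRing.norm_coe_unitary_mul,
      Matrix.l2_opNorm_diagonal, pi_norm_le_iff_of_nonneg zero_le_one]
    intro i
    rcases lt_trichotomy (hY.eigenvalues i) 0 with h | h | h <;> simp [h]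
  · rw [trace_mul_eq_sum_eigenvalues hY, traceNorm_eq_sum_abs_eigenvalues hY, Complex.re_sum]
    refine Finset.sum_congr rfl fun i _ => ?_
    have h : star (U : Matrix n n ℂ) * (U * D * star (U : Matrix n n ℂ)) * U = D := by
      have h1 : star (U : Matrix n n ℂ) * U = 1 := Unitary.coe_star_mul_self U
      calc _ = (star (U : Matrix n n ℂ) * U) * D * (star (U : Matrix n n ℂ) * U) := by
            simp only [mul_assoc]
        _ = D := by rw [h1, one_mul, mul_one]
    have hDi : D i i = ((SignType.sign (hY.eigenvalues i) : ℝ) : ℂ) :=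
      Matrix.diagonal_apply_eq _ i
    rw [h, hDi, ← Complex.ofReal_mul, Complex.ofReal_re]
    exact sign_mul_self _

lemma traceNorm_smul_le {Y : Matrix n n ℂ} (hY : Y.IsHermitian) {c : ℝ} (hc : 0 ≤ c) :
    traceNorm (c • Y) ≤ c * traceNorm Y := by
  have hcY : (c • Y).IsHermitian := hY.smul (IsSelfAdjoint.all c)
  obtain ⟨X, -, hX, h⟩ := exists_re_trace_mul_eq_traceNorm hcY
  rw [← h, Matrix.mul_smul, Matrix.trace_smul, Complex.smul_re, smul_eq_mul]
  gcongr
  refine (re_trace_mul_le hY X).trans ?_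
  exact mul_le_of_le_one_left (traceNorm_nonneg Y) hX

lemma opNorm_eq_norm [Nonempty n] (A : Matrix n n ℂ) : opNorm A = ‖A‖ := by
  set hA := (Matrix.posSemidef_conjTranspose_mul_self A).1
  have hnn := Matrix.eigenvalues_conjTranspose_mul_self_nonneg A
  have hnorm : ‖fun i => (hA.eigenvalues i : ℂ)‖ = ‖A‖ * ‖A‖ := by
    rw [← Matrix.l2_opNorm_conjTranspose_mul_self, ← Matrix.l2_opNorm_diagonal]
    conv_rhs => rw [hA.spectral_theorem, Unitary.conjStarAlgAut_apply, ← Unitary.coe_star,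
      CStarRing.norm_mul_coe_unitary, CStarRing.norm_coe_unitary_mul]
    rfl
  unfold opNorm
  apply le_antisymm
  · refine ciSup_le fun i => Real.sqrt_le_iff.2 ⟨norm_nonneg _, ?_⟩
    have h := norm_le_pi_norm (fun i => (hA.eigenvalues i : ℂ)) i
    rw [hnorm, Complex.norm_real, ← sq] at h
    exact (le_abs_self _).trans h
  · set s := ⨆ i, Real.sqrt (hA.eigenvalues i)
    have hs : ∀ i, Real.sqrt (hA.eigenvalues i) ≤ s := le_ciSup (Set.finite_range _).bddAbove
    have hs0 : 0 ≤ s := Real.iSup_nonneg fun i => Real.sqrt_nonneg _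
    refine abs_le_of_sq_le_sq' ?_ hs0 |>.2
    rw [sq, ← hnorm, pi_norm_le_iff_of_nonneg (sq_nonneg s)]
    intro i
    rw [Complex.norm_real, Real.norm_of_nonneg (hnn i)]
    exact (Real.sqrt_le_left hs0).1 (hs i)

end Norms

section Trace

lemma re_trace_mul_nonneg {A B : Matrix n n ℂ} (hA : A.PosSemidef) (hB : B.PosSemidef) :
    0 ≤ ((A * B).trace).re := by
  obtain ⟨C, rfl⟩ := CStarAlgebra.nonneg_iff_eq_star_mul_self.mp hA.nonneg
  rw [mul_assoc, Matrix.trace_mul_comm, Matrix.star_eq_conjTranspose]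
  exact (Complex.le_def.1 (hB.mul_mul_conjTranspose_same C).trace_nonneg).1

lemma posSemidef_of_re_trace_mul_nonneg {m : Type*} [Fintype m] {W : Matrix m m ℂ}
    (hW : W.IsHermitian) (h : ∀ A : Matrix m m ℂ, A.PosSemidef → 0 ≤ ((W * A).trace).re) : W.PosSemidef := by
  refine Matrix.PosSemidef.of_dotProduct_mulVec_nonneg hW fun x => ?_
  have h1 := h _ (Matrix.posSemidef_vecMulVec_self_star x)
  rw [Matrix.mul_vecMulVec, Matrix.trace_vecMulVec, dotProduct_comm] at h1
  exact Complex.le_def.2 ⟨h1, (hW.im_star_dotProduct_mulVec_self x).symm⟩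

lemma re_trace_mul_le_of_abs_le {P S Y Z : Matrix n n ℂ} (h1 : (S + Y).PosSemidef)
    (h2 : (Y - S).PosSemidef) (h3 : (P + Z).PosSemidef) (h4 : (Z - P).PosSemidef) :
    ((P * S).trace).re ≤ ((Z * Y).trace).re := by
  have h5 := re_trace_mul_nonneg h4 h1
  have h6 := re_trace_mul_nonneg h3 h2
  simp only [add_mul, sub_mul, mul_add, mul_sub, Matrix.trace_add, Matrix.trace_sub,
    Complex.add_re, Complex.sub_re] at h5 h6
  linarith

/-- On Hermitian matrices, the real part of a linear functional is a trace pairing with a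
Hermitian matrix. -/
lemma exists_isHermitian_re_trace_mul (g : Matrix n n ℂ →ₗ[ℂ] ℂ) :
    ∃ W : Matrix n n ℂ, W.IsHermitian ∧
      ∀ X : Matrix n n ℂ, X.IsHermitian → (g X).re = ((W * X).trace).re := by
  let V : Matrix n n ℂ := Matrix.of fun i j => g (Matrix.single j i 1)
  have hV : ∀ X, g X = (V * X).trace := by
    intro X
    conv_lhs => rw [Matrix.matrix_eq_sum_single X]
    simp only [map_sum, Matrix.trace, Matrix.diag, Matrix.mul_apply]
    rw [Finset.sum_comm]
    refine Finset.sum_congr rfl fun i _ => Finset.sum_congr rfl fun j _ => ?_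
    have : Matrix.single j i (X j i) = X j i • Matrix.single j i (1 : ℂ) := by simp
    rw [this, map_smul, smul_eq_mul, mul_comm]
    rfl
  refine ⟨(1 / 2 : ℝ) • (V + Vᴴ), ?_, fun X hX => ?_⟩
  · refine Matrix.IsHermitian.smul ?_ (IsSelfAdjoint.all _)
    exact Matrix.isHermitian_add_transpose_self V
  · have h : (Vᴴ * X).trace = star (V * X).trace := by
      rw [← Matrix.trace_conjTranspose, Matrix.conjTranspose_mul, hX.eq, Matrix.trace_mul_comm]
    have h' : ((Vᴴ * X).trace).re = ((V * X).trace).re := by rw [h]; exact Complex.conj_re _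
    rw [Matrix.smul_mul, Matrix.trace_smul, Complex.smul_re, add_mul, Matrix.trace_add,
      Complex.add_re, h', hV, smul_eq_mul]
    ring

end Trace

section PartialTranspose

variable {α β : Type*}

lemma ptB_ptB (X : Matrix (α × β) (α × β) ℂ) : ptB (ptB X) = X := rfl

lemma ptB_add (X Y : Matrix (α × β) (α × β) ℂ) : ptB (X + Y) = ptB X + ptB Y := rfl

lemma ptB_smul (c : ℝ) (X : Matrix (α × β) (α × β) ℂ) : ptB (c • X) = c • ptB X := rfl

lemma isHermitian_ptB {X : Matrix (α × β) (α × β) ℂ} (hX : X.IsHermitian) :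
    (ptB X).IsHermitian :=
  Matrix.IsHermitian.ext fun i j => hX.apply (i.1, j.2) (j.1, i.2)

lemma continuous_ptB : Continuous (ptB : Matrix (α × β) (α × β) ℂ → _) :=
  continuous_pi fun i => continuous_pi fun j =>
    (continuous_apply (j.1, i.2)).comp (continuous_apply (i.1, j.2))

lemma trace_ptB_mul [Fintype α] [Fintype β] (X Y : Matrix (α × β) (α × β) ℂ) :
    (ptB X * Y).trace = (X * ptB Y).trace := by
  simp only [Matrix.trace, Matrix.diag, Matrix.mul_apply, ptB, Matrix.of_apply,
    Fintype.sum_prod_type]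
  refine Finset.sum_congr rfl fun a _ => ?_
  rw [Finset.sum_comm_cycle]
  exact Finset.sum_congr rfl fun b _ => Finset.sum_comm

end PartialTranspose

lemma isHermitian_suppProj (A : Matrix n n ℂ) : (suppProj A).IsHermitian := by
  unfold suppProj
  split_ifs with hA
  · refine Matrix.isHermitian_mul_mul_conjTranspose _ ?_
    refine Matrix.isHermitian_diagonal_of_self_adjoint _ ?_
    ext i
    by_cases h : hA.eigenvalues i = 0 <;> simp [h]
  · exact Matrix.isHermitian_zero

/-- Separation of the positive cone from a compact convex set of pairs of Hermitian matrices. -/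
lemma exists_posSemidef_separating {K : Set (Matrix n n ℂ × Matrix n n ℂ)} (hK : Convex ℝ K)
    (hKc : IsCompact K) (hKh : ∀ p ∈ K, p.1.IsHermitian ∧ p.2.IsHermitian)
    (hdisj : ∀ p ∈ K, ¬ (p.1.PosSemidef ∧ p.2.PosSemidef)) :
    ∃ U V : Matrix n n ℂ, U.PosSemidef ∧ V.PosSemidef ∧
      ∀ p ∈ K, ((U * p.1).trace).re + ((V * p.2).trace).re < 0 := by
  have hcone : IsClosed (Set.Ici (0 : Matrix n n ℂ × Matrix n n ℂ)) := by
    have h : Set.Ici (0 : Matrix n n ℂ × Matrix n n ℂ) =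
        Set.Ici (0 : Matrix n n ℂ) ×ˢ Set.Ici (0 : Matrix n n ℂ) := by
      rw [Set.Ici_prod_Ici]; rfl
    rw [h]
    exact CStarAlgebra.isClosed_nonneg.prod CStarAlgebra.isClosed_nonneg
  obtain ⟨f, u, v, hu, huv, hv⟩ := RCLike.geometric_hahn_banach_compact_closed (𝕜 := ℂ) hK hKc
    (convex_Ici (𝕜 := ℝ) (0 : Matrix n n ℂ × Matrix n n ℂ)) hcone
    (Set.disjoint_left.2 fun p hp hp0 => hdisj p hp
      ⟨Matrix.nonneg_iff_posSemidef.1 hp0.1, Matrix.nonneg_iff_posSemidef.1 hp0.2⟩)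
  have hv0 : v < 0 := by simpa using hv 0 Set.self_mem_Ici
  have hpos : ∀ b : Matrix n n ℂ × Matrix n n ℂ, 0 ≤ b → 0 ≤ (f b).re := by
    intro b hb
    by_contra! hneg
    have h1 := hv ((v / (f b).re) • b)
      (smul_nonneg (div_nonneg_of_nonpos hv0.le hneg.le) hb)
    have h2 : f ((v / (f b).re) • b) = (v / (f b).re) • f b :=
      (f.restrictScalars ℝ).map_smul _ _
    rw [h2] at h1
    simp only [RCLike.re_to_complex, Complex.smul_re, smul_eq_mul] at h1
    rw [div_mul_cancel₀ _ hneg.ne] at h1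
    exact lt_irrefl _ h1
  obtain ⟨U, hU, hfU⟩ := exists_isHermitian_re_trace_mul
    ((f : _ →ₗ[ℂ] ℂ) ∘ₗ LinearMap.inl ℂ (Matrix n n ℂ) (Matrix n n ℂ))
  obtain ⟨V, hV, hfV⟩ := exists_isHermitian_re_trace_mul
    ((f : _ →ₗ[ℂ] ℂ) ∘ₗ LinearMap.inr ℂ (Matrix n n ℂ) (Matrix n n ℂ))
  refine ⟨U, V, posSemidef_of_re_trace_mul_nonneg hU fun A hA => ?_,
    posSemidef_of_re_trace_mul_nonneg hV fun A hA => ?_, fun p hp => ?_⟩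
  · rw [← hfU A hA.1]
    exact hpos (A, 0) ⟨hA.nonneg, le_rfl⟩
  · rw [← hfV A hA.1]
    exact hpos (0, A) ⟨le_rfl, hA.nonneg⟩
  · rw [← hfU _ (hKh p hp).1, ← hfV _ (hKh p hp).2, ← Complex.add_re]
    have h : f p = f (p.1, 0) + f (0, p.2) := by rw [← map_add]; simp
    have h1 := hu p hp
    rw [h] at h1
    exact h1.trans (huv.trans hv0)

/-- Every Hermitian matrix is dominated in absolute value by a multiple of the identity. -/
lemma exists_isHermitian_abs_le {P : Matrix n n ℂ} (hP : P.IsHermitian) :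
    ∃ Z : Matrix n n ℂ, Z.IsHermitian ∧ (P + Z).PosSemidef ∧ (Z - P).PosSemidef := by
  refine ⟨algebraMap ℝ _ ‖P‖, (IsSelfAdjoint.all ‖P‖).algebraMap _, ?_, ?_⟩
  · have h := IsSelfAdjoint.neg_algebraMap_norm_le_self (a := P) hP.isSelfAdjoint
    rw [Matrix.le_iff] at h
    simpa using h
  · exact Matrix.le_iff.1 (IsSelfAdjoint.le_algebraMap_norm_self (a := P) hP.isSelfAdjoint)

section Bipartite

variable {α β : Type*} [Fintype α] [Fintype β] [DecidableEq (α × β)]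

/-- If every feasible `Z` has norm above `t`, some dual feasible pair has value above `t`. -/
lemma exists_dual_of_no_primal {P : Matrix (α × β) (α × β) ℂ} (hP : P.IsHermitian) {t : ℝ}
    (ht : 0 ≤ t) (hno : ∀ Z : Matrix (α × β) (α × β) ℂ, Z.IsHermitian → (P + Z).PosSemidef →
      (Z - P).PosSemidef → t < ‖ptB Z‖) :
    ∃ S Y : Matrix (α × β) (α × β) ℂ, S.IsHermitian ∧ Y.IsHermitian ∧ (S + Y).PosSemidef ∧
      (Y - S).PosSemidef ∧ t * traceNorm (ptB Y) < ((P * S).trace).re := by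
  let B : Set (Matrix (α × β) (α × β) ℂ) := Metric.closedBall 0 t ∩ {X | X.IsHermitian}
  let φ : Matrix (α × β) (α × β) ℂ → Matrix (α × β) (α × β) ℂ × Matrix (α × β) (α × β) ℂ :=
    fun X => (ptB X - P, ptB X + P)
  have hherm : IsClosed {X : Matrix (α × β) (α × β) ℂ | X.IsHermitian} :=
    isClosed_eq continuous_star continuous_id
  have : ProperSpace (Matrix (α × β) (α × β) ℂ) := FiniteDimensional.proper ℂ _
  have hBc : IsCompact B := (isCompact_closedBall _ _).inter_right hherm
  have hBconv : Convex ℝ B := (convex_closedBall _ _).inter fun X hX Y hY a b _ _ _ =>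
    Matrix.IsHermitian.add (hX.smul (IsSelfAdjoint.all a)) (hY.smul (IsSelfAdjoint.all b))
  have hφ : Continuous φ :=
    (continuous_ptB.sub continuous_const).prodMk (continuous_ptB.add continuous_const)
  have hconv : Convex ℝ (φ '' B) := by
    rintro _ ⟨X, hX, rfl⟩ _ ⟨Y, hY, rfl⟩ a b ha hb hab
    refine ⟨a • X + b • Y, hBconv hX hY ha hb hab, ?_⟩
    have hPab : P = a • P + b • P := by rw [← add_smul, hab, one_smul]
    refine Prod.ext ?_ ?_
    · change ptB (a • X + b • Y) - P = a • (ptB X - P) + b • (ptB Y - P)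
      rw [ptB_add, ptB_smul, ptB_smul, smul_sub, smul_sub]
      nth_rewrite 1 [hPab]
      abel
    · change ptB (a • X + b • Y) + P = a • (ptB X + P) + b • (ptB Y + P)
      rw [ptB_add, ptB_smul, ptB_smul, smul_add, smul_add]
      nth_rewrite 1 [hPab]
      abel
  obtain ⟨U, V, hU, hV, hUV⟩ := exists_posSemidef_separating hconv (hBc.image hφ)
    (by
      rintro _ ⟨X, hX, rfl⟩
      exact ⟨(isHermitian_ptB hX.2).sub hP, (isHermitian_ptB hX.2).add hP⟩)
    (by
      rintro _ ⟨X, hX, rfl⟩ ⟨h1, h2⟩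
      refine (hno (ptB X) (isHermitian_ptB hX.2) (by rwa [add_comm]) h1).not_ge ?_
      rw [ptB_ptB]
      exact mem_closedBall_zero_iff.1 hX.1)
  have hY : (U + V).IsHermitian := hU.1.add hV.1
  refine ⟨U - V, U + V, hU.1.sub hV.1, hY, ?_, ?_, ?_⟩
  · have h : U - V + (U + V) = U + U := by abel
    rw [h]
    exact hU.add hU
  · have h : U + V - (U - V) = V + V := by abel
    rw [h]
    exact hV.add hV
  · obtain ⟨X, hX, hX1, hXt⟩ := exists_re_trace_mul_eq_traceNorm (isHermitian_ptB hY)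
    have htX : t • X ∈ B := by
      refine ⟨mem_closedBall_zero_iff.2 ?_, hX.smul (IsSelfAdjoint.all t)⟩
      rw [norm_smul, Real.norm_of_nonneg ht]
      exact mul_le_of_le_one_right ht hX1
    have h1 := hUV _ ⟨_, htX, rfl⟩
    have h2 : ((ptB (t • X) * (U + V)).trace).re = t * traceNorm (ptB (U + V)) := by
      rw [trace_ptB_mul, Matrix.smul_mul, Matrix.trace_smul, Complex.smul_re, hXt, smul_eq_mul]
    rw [← h2]
    simp only [φ, mul_add, mul_sub, Matrix.trace_add, Matrix.trace_sub, Complex.add_re,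
      Complex.sub_re] at h1 ⊢
    rw [Matrix.trace_mul_comm _ U, Matrix.trace_mul_comm _ V, Matrix.trace_mul_comm P U,
      Matrix.trace_mul_comm P V]
    linarith

lemma re_trace_mul_le_norm_mul_traceNorm {P S Y Z : Matrix (α × β) (α × β) ℂ}
    (hY : Y.IsHermitian) (h1 : (S + Y).PosSemidef) (h2 : (Y - S).PosSemidef)
    (h3 : (P + Z).PosSemidef) (h4 : (Z - P).PosSemidef) :
    ((P * S).trace).re ≤ ‖ptB Z‖ * traceNorm (ptB Y) := by
  refine (re_trace_mul_le_of_abs_le h1 h2 h3 h4).trans ?_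
  rw [← ptB_ptB Z, trace_ptB_mul, ptB_ptB]
  exact re_trace_mul_le (isHermitian_ptB hY) _

end Bipartite

/-- Strong duality between the norm of dominating operators and the pairing with the
Wang–Duan set. -/
lemma sInf_opNorm_eq_sSup_memWD {dA dB : ℕ} [Nonempty (Fin dA × Fin dB)]
    {Q : Matrix (Fin dA × Fin dB) (Fin dA × Fin dB) ℂ} (hQ : Q.IsHermitian) :
    sInf {r : ℝ | ∃ Y : Matrix (Fin dA × Fin dB) (Fin dA × Fin dB) ℂ,
        Y.IsHermitian ∧ (ptB Q + Y).PosSemidef ∧ (Y - ptB Q).PosSemidef ∧ r = opNorm (ptB Y)} =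
      sSup {r : ℝ | ∃ σ : Matrix (Fin dA × Fin dB) (Fin dA × Fin dB) ℂ,
        memWD σ ∧ r = ((Q * σ).trace).re} := by
  have hP := isHermitian_ptB hQ
  simp only [opNorm_eq_norm]
  set I := {r : ℝ | ∃ Y : Matrix (Fin dA × Fin dB) (Fin dA × Fin dB) ℂ,
    Y.IsHermitian ∧ (ptB Q + Y).PosSemidef ∧ (Y - ptB Q).PosSemidef ∧ r = ‖ptB Y‖}
  set J := {r : ℝ | ∃ σ : Matrix (Fin dA × Fin dB) (Fin dA × Fin dB) ℂ,
    memWD σ ∧ r = ((Q * σ).trace).re}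
  obtain ⟨Z₀, hZ₀, hZ₁, hZ₂⟩ := exists_isHermitian_abs_le hP
  have hIne : I.Nonempty := ⟨_, Z₀, hZ₀, hZ₁, hZ₂, rfl⟩
  have hIbdd : BddBelow I := by
    refine ⟨0, ?_⟩
    rintro _ ⟨Y, -, -, -, rfl⟩
    exact norm_nonneg _
  have hzero : (0 : ℝ) ∈ J := by
    refine ⟨0, ⟨Matrix.isHermitian_zero, 0, Matrix.isHermitian_zero, ?_, ?_, ?_⟩, by simp⟩
    · exact (add_zero (0 : Matrix (Fin dA × Fin dB) (Fin dA × Fin dB) ℂ)).symm ▸ .zero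
    · exact (sub_zero (0 : Matrix (Fin dA × Fin dB) (Fin dA × Fin dB) ℂ)).symm ▸ .zero
    · have h := traceNorm_smul_le
        (Matrix.isHermitian_zero (n := Fin dA × Fin dB) (α := ℂ)) le_rfl
      rw [zero_smul, zero_mul] at h
      exact h.trans zero_le_one
  have hweak : ∀ s ∈ J, ∀ r ∈ I, s ≤ r := by
    rintro _ ⟨σ, ⟨-, Y, hY, h1, h2, hY1⟩, rfl⟩ _ ⟨Z, -, h3, h4, rfl⟩
    rw [← ptB_ptB Q, trace_ptB_mul]
    exact (re_trace_mul_le_norm_mul_traceNorm hY h1 h2 h3 h4).trans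
      (mul_le_of_le_one_right (norm_nonneg _) hY1)
  obtain ⟨r₀, hr₀⟩ := hIne
  have hJbdd : BddAbove J := ⟨r₀, fun s hs => hweak s hs r₀ hr₀⟩
  refine le_antisymm (le_of_forall_lt fun t ht => ?_)
    (csSup_le ⟨0, hzero⟩ fun s hs => le_csInf ⟨r₀, hr₀⟩ fun r hr => hweak s hs r hr)
  rcases lt_or_ge t 0 with ht0 | ht0
  · exact ht0.trans_le (le_csSup hJbdd hzero)
  obtain ⟨S, Y, hS, hY, h1, h2, h3⟩ := exists_dual_of_no_primal hP ht0 fun Z hZ hZ1 hZ2 =>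
    ht.trans_le (csInf_le hIbdd ⟨Z, hZ, hZ1, hZ2, rfl⟩)
  set τ := traceNorm (ptB Y)
  have hτ : 0 < τ := by
    refine (traceNorm_nonneg _).lt_of_ne fun (h : 0 = τ) => ?_
    have h4 : t * τ < _ * τ := h3.trans_le (re_trace_mul_le_norm_mul_traceNorm hY h1 h2 hZ₁ hZ₂)
    rw [← h, mul_zero, mul_zero] at h4
    exact lt_irrefl _ h4
  refine lt_of_lt_of_le ?_ (le_csSup hJbdd ⟨ptB (τ⁻¹ • S), ⟨isHermitian_ptB
    (hS.smul (IsSelfAdjoint.all _)), τ⁻¹ • Y, hY.smul (IsSelfAdjoint.all _), ?_, ?_, ?_⟩, rfl⟩)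
  · rw [← trace_ptB_mul, Matrix.mul_smul, Matrix.trace_smul, Complex.smul_re, smul_eq_mul,
      inv_mul_eq_div, lt_div_iff₀ hτ]
    exact h3
  · rw [ptB_ptB, ← smul_add]
    exact h1.smul (inv_nonneg.2 hτ.le)
  · rw [ptB_ptB, ← smul_sub]
    exact h2.smul (inv_nonneg.2 hτ.le)
  · rw [ptB_smul, ← inv_mul_cancel₀ hτ.ne']
    exact traceNorm_smul_le (isHermitian_ptB hY) (inv_nonneg.2 hτ.le)

end Duality

/-- `E_{WD,2}(ρ) = D_min(ρ‖WD(A:B))`, i.e.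
`inf{‖Y^{T_B}‖_∞ : −Y ≤ Π_ρ^{T_B} ≤ Y} = sup{tr[Π_ρ σ] : σ ∈ WD(A:B)}`. -/
theorem EWD2_eq_Dmin_WD {dA dB : ℕ} (ρ : Matrix (Fin dA × Fin dB) (Fin dA × Fin dB) ℂ)
    (hρ : ρ.PosSemidef) (hρ1 : ρ.trace = 1) :
    sInf {r : ℝ | ∃ Y : Matrix (Fin dA × Fin dB) (Fin dA × Fin dB) ℂ,
        Y.IsHermitian ∧ (ptB (suppProj ρ) + Y).PosSemidef ∧
        (Y - ptB (suppProj ρ)).PosSemidef ∧ r = opNorm (ptB Y)} =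
      sSup {r : ℝ | ∃ σ : Matrix (Fin dA × Fin dB) (Fin dA × Fin dB) ℂ,
        memWD σ ∧ r = ((suppProj ρ * σ).trace).re} := by
  have : Nonempty (Fin dA × Fin dB) := by
    by_contra h
    rw [not_nonempty_iff] at h
    simp [Matrix.trace] at hρ1
  exact sInf_opNorm_eq_sSup_memWD (isHermitian_suppProj ρ)

end QIT
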